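/- Let 2 ≤ k ≤ n−2, let h_1,…,h_n ∈ F_q^k be the columns of H(k), and suppose the residue elliptic code C = C_Ω(D,kO) has covering radius k−1. Then a word v ∈ F_q^n is a deep hole of C if and only if the n+1 vectors h_1,…,h_n, H(k)vᵀ form an (n+1)-track in PG(k−1,q), i.e.: (i) every k−1 of these n+1 vectors are linearly independent over F_q, and (ii) some k of these n+1 vectors are linearly dependent (equivalently, there is a hyperplane through k of the corresponding projective points). -/

import Mathlib

open Matrix BigOperators

/-- Values of the `k` monomials `x^i y^j` (`j ∈ {0,1}`, `2i+3j ≤ k`), a basis of the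
Riemann–Roch space `L(kO)`, at an affine point `P = (α, β)`:
`(1, α, …, α^⌊k/2⌋, β, αβ, …, α^⌊(k−3)/2⌋ β)`. -/
def phiAff {F : Type*} [Field F] (k : ℕ) (P : F × F) : Fin k → F :=
  fun j => if (j : ℕ) ≤ k / 2 then P.1 ^ (j : ℕ) else P.2 * P.1 ^ ((j : ℕ) - k / 2 - 1)

/-- The vector `φ_k(O)` attached to the point at infinity: the standard unit vector supported
at the coordinate of `x^{k/2}` (`k` even) resp. `x^{(k-3)/2} y` (`k` odd). -/
def phiInf (F : Type*) [Field F] (k : ℕ) : Fin k → F :=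
  fun j => if (j : ℕ) = (if k % 2 = 0 then k / 2 else k - 1) then 1 else 0

/-- The parity-check matrix `H(k)` with columns `φ_k(P_1), …, φ_k(P_n)`. -/
def Hmat {F : Type*} [Field F] {n : ℕ} (k : ℕ) (P : Fin n → F × F) :
    Matrix (Fin k) (Fin n) F := fun i j => phiAff k (P j) i

/-- The functional elliptic code `C_L(D, kO)`: the row space of `H(k)`. -/
def funcCode {F : Type*} [Field F] {n : ℕ} (k : ℕ) (P : Fin n → F × F) :
    Set (Fin n → F) := {v | ∃ u : Fin k → F, v = Matrix.vecMul u (Hmat k P)}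

/-- The residue elliptic code `C_Ω(D, kO) = {v : H(k) vᵀ = 0}`. -/
def resCode {F : Type*} [Field F] {n : ℕ} (k : ℕ) (P : Fin n → F × F) :
    Set (Fin n → F) := {v | Matrix.mulVec (Hmat k P) v = 0}

/-- Error distance `d(v, C)` from a word to a code. -/
noncomputable def dTo {F : Type*} [DecidableEq F] {n : ℕ} (v : Fin n → F) (C : Set (Fin n → F)) : ℕ :=
  sInf (hammingDist v '' C)

/-- Covering radius `ρ(C) = max_v d(v, C)`. -/
noncomputable def covRad {F : Type*} [DecidableEq F] {n : ℕ} (C : Set (Fin n → F)) : ℕ :=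
  sSup (Set.range fun v : Fin n → F => dTo v C)

/-- Minimum distance: the least Hamming weight of a nonzero codeword. -/
noncomputable def minDist {F : Type*} [DecidableEq F] [Zero F] {n : ℕ} (C : Set (Fin n → F)) : ℕ :=
  sInf ((fun c => hammingDist c 0) '' (C \ {0}))

/-- Dimension of a code (as the dimension of its linear span). -/
noncomputable def dimCode (F : Type*) [Field F] {n : ℕ} (C : Set (Fin n → F)) : ℕ :=
  Module.finrank F (Submodule.span F C)

/-- `(α, β)` is an affine rational point of the curve `y² = x³ + s x + t`. -/
def onCurve {F : Type*} [Field F] (s t : F) (P : F × F) : Prop :=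
  P.2 ^ 2 = P.1 ^ 3 + s * P.1 + t

/-- The number `|E(F_q)|` of rational points: affine points plus the point at infinity. -/
def numPoints (F : Type*) [Field F] [Fintype F] [DecidableEq F] (s t : F) : ℕ :=
  (Finset.univ.filter (fun P : F × F => P.2 ^ 2 = P.1 ^ 3 + s * P.1 + t)).card + 1

/-- Distinct `F`-rational points impose independent conditions on an `F`-algebra. -/
lemma AlgHom.pi_surjective_of_injective {F A ι : Type*} [Field F] [CommRing A] [Algebra F A]
    [Fintype ι] {e : ι → A →ₐ[F] F} (he : Function.Injective e) :
    Function.Surjective (LinearMap.pi fun i => (e i).toLinearMap : A →ₗ[F] ι → F) := by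
  classical
  rw [← LinearMap.range_eq_top]
  by_contra hne
  obtain ⟨f, hf0, hf⟩ := Submodule.exists_le_ker_of_lt_top _ (lt_top_iff_ne_top.2 hne)
  have hli : LinearIndependent F (fun i : ι => (e i : A → F)) :=
    (linearIndependent_monoidHom A F).comp (fun i => ((e i : A →* F)))
      fun i j hij => he (AlgHom.ext fun a => DFunLike.congr_fun hij a)
  refine hf0 (LinearMap.pi_ext' fun i => LinearMap.ext_ring ?_)
  refine Fintype.linearIndependent_iff.1 hli (fun i => f (Pi.single i 1)) ?_ i
  ext a
  have ha := hf (LinearMap.mem_range_self _ a)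
  rw [LinearMap.mem_ker, LinearMap.pi_apply_eq_sum_univ] at ha
  have hs (i : ι) : (fun j => if i = j then (1 : F) else 0) = Pi.single i 1 := by
    ext j
    simp [Pi.single_apply, eq_comm]
  simpa [Finset.sum_apply, mul_comm, hs, eq_comm] using ha

namespace WeierstrassCurve.Affine.CoordinateRing

open Polynomial
open scoped Polynomial.Bivariate

variable {F : Type*} [Field F] {W : WeierstrassCurve.Affine F}

lemma natDegree_norm_le_iff (p q : F[X]) (m : ℕ) :
    (Algebra.norm F[X] (p • 1 + q • mk W Y)).natDegree ≤ m ↔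
      (∀ i, p.coeff i ≠ 0 → 2 * i ≤ m) ∧ ∀ i, q.coeff i ≠ 0 → 2 * i + 3 ≤ m := by
  rw [natDegree_le_iff_degree_le, degree_norm_smul_basis, max_le_iff]
  refine and_congr ?_ ?_
  · rcases eq_or_ne p 0 with rfl | hp
    · simp
    · rw [degree_eq_natDegree hp]
      have : (2 • (p.natDegree : WithBot ℕ) ≤ m) ↔ 2 * p.natDegree ≤ m := by
        rw [two_nsmul, two_mul]; norm_cast
      rw [this]
      refine ⟨fun h i hi => ?_, fun h => h _ (by simpa using hp)⟩
      have := le_natDegree_of_ne_zero hi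
      omega
  · rcases eq_or_ne q 0 with rfl | hq
    · simp
    · rw [degree_eq_natDegree hq]
      have : (2 • (q.natDegree : WithBot ℕ) + 3 ≤ m) ↔ 2 * q.natDegree + 3 ≤ m := by
        rw [two_nsmul, two_mul]; norm_cast
      rw [this]
      refine ⟨fun h i hi => ?_, fun h => h _ (by simpa using hq)⟩
      have := le_natDegree_of_ne_zero hi
      omega

lemma exists_eq_algebraMap_of_natDegree_norm_eq_zero {f : W.CoordinateRing}
    (hf : (Algebra.norm F[X] f).natDegree = 0) : ∃ c : F, f = algebraMap F _ c := by
  obtain ⟨p, q, rfl⟩ := exists_smul_basis_eq f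
  obtain ⟨hp, hq⟩ := (natDegree_norm_le_iff p q 0).1 hf.le
  have hq0 : q = 0 := by
    ext i
    by_contra h
    have := hq i h
    omega
  have hp0 : p = C (p.coeff 0) := by
    refine eq_C_of_natDegree_le_zero (natDegree_le_iff_coeff_eq_zero.2 fun i hi => ?_)
    by_contra h
    have := hp i h
    omega
  refine ⟨p.coeff 0, ?_⟩
  rw [hq0, zero_smul, add_zero, hp0, Algebra.smul_def, mul_one, coeff_C_zero]
  exact (IsScalarTower.algebraMap_apply F F[X] W.CoordinateRing _).symm

lemma finite_quotient_span_singleton {f : W.CoordinateRing} (hf : f ≠ 0) :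
    Module.Finite F (W.CoordinateRing ⧸ Ideal.span {f}) := by
  classical
  exact Module.Finite.equiv (Ideal.quotientEquivDirectSum F (CoordinateRing.basis W)
    (Ideal.span_singleton_eq_bot.not.2 hf)).symm

/-- A function with at most `#ι` poles vanishing at `#ι` rational points is unique up to scalars
among functions with at most `#ι + 1` poles: there is no function with a single pole. -/
lemma exists_eq_smul_of_vanishing {ι : Type*} [Fintype ι] {e : ι → W.CoordinateRing →ₐ[F] F}
    (he : Function.Injective e) {f g : W.CoordinateRing} (hf0 : f ≠ 0)
    (hf : ∀ i, e i f = 0) (hg : ∀ i, e i g = 0)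
    (hfd : (Algebra.norm F[X] f).natDegree ≤ Fintype.card ι)
    (hgd : (Algebra.norm F[X] g).natDegree ≤ Fintype.card ι + 1) :
    ∃ c : F, g = c • f := by
  have := finite_quotient_span_singleton hf0
  let π : W.CoordinateRing →ₗ[F] ι → F := LinearMap.pi fun i => (e i).toLinearMap
  have hπ : Function.Surjective π := AlgHom.pi_surjective_of_injective he
  let I : Ideal W.CoordinateRing := Ideal.span {f}
  have hI : I.restrictScalars F ≤ LinearMap.ker π := by
    intro a ha
    obtain ⟨b, rfl⟩ := Ideal.mem_span_singleton.1 (show a ∈ I from ha)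
    refine LinearMap.mem_ker.2 (funext fun i => ?_)
    simp [π, hf i]
  let ψ : (W.CoordinateRing ⧸ I) →ₗ[F] ι → F := (I.restrictScalars F).liftQ π hI
  have hψ : Function.Surjective ψ := fun x => by
    obtain ⟨a, rfl⟩ := hπ x
    exact ⟨Ideal.Quotient.mk I a, rfl⟩
  have hrank : Module.finrank F (W.CoordinateRing ⧸ I) = (Algebra.norm F[X] f).natDegree :=
    finrank_quotient_span_eq_natDegree_norm (CoordinateRing.basis W) hf0
  have hle := LinearMap.finrank_le_finrank_of_surjective hψ
  rw [Module.finrank_fintype_fun_eq_card, hrank] at hle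
  have hinj : Function.Injective ψ :=
    (LinearMap.injective_iff_surjective_of_finrank_eq_finrank (by
      rw [hrank, Module.finrank_fintype_fun_eq_card]; omega)).2 hψ
  have hgI : g ∈ I := by
    refine Ideal.Quotient.eq_zero_iff_mem.1 (hinj ?_)
    rw [map_zero]
    exact funext hg
  obtain ⟨a, rfl⟩ := Ideal.mem_span_singleton.1 hgI
  rcases eq_or_ne a 0 with rfl | ha
  · exact ⟨0, by simp⟩
  have hN (x : W.CoordinateRing) (hx : x ≠ 0) : Algebra.norm F[X] x ≠ 0 :=
    fun h => hx ((Algebra.norm_eq_zero_iff_of_basis (CoordinateRing.basis W)).1 h)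
  rw [map_mul, natDegree_mul (hN f hf0) (hN a ha)] at hgd
  have ha1 := natDegree_norm_ne_one a
  obtain ⟨c, rfl⟩ := exists_eq_algebraMap_of_natDegree_norm_eq_zero (f := a) (by omega)
  exact ⟨c, by rw [Algebra.smul_def, mul_comm]⟩

end WeierstrassCurve.Affine.CoordinateRing

section RiemannRochSpace

open Polynomial WeierstrassCurve.Affine
open scoped Polynomial.Bivariate

variable {F : Type*} [Field F]

/-- The short Weierstrass curve `y² = x³ + s x + t`. -/
abbrev shortCurve (s t : F) : WeierstrassCurve.Affine F := ⟨0, 0, 0, s, t⟩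

/-- The part in `x` alone of the function in `L(kO)` with coefficients `u`. -/
noncomputable def constPart (k : ℕ) : (Fin k → F) →ₗ[F] F[X] :=
  Fintype.linearCombination F fun j => if (j : ℕ) ≤ k / 2 then X ^ (j : ℕ) else 0

/-- The coefficient of `y` of the function in `L(kO)` with coefficients `u`. -/
noncomputable def linPart (k : ℕ) : (Fin k → F) →ₗ[F] F[X] :=
  Fintype.linearCombination F fun j => if (j : ℕ) ≤ k / 2 then 0 else X ^ ((j : ℕ) - k / 2 - 1)

lemma coeff_constPart {k : ℕ} (u : Fin k → F) (i : ℕ) :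
    (constPart k u).coeff i = if h : i < k ∧ i ≤ k / 2 then u ⟨i, h.1⟩ else 0 := by
  simp only [constPart, Fintype.linearCombination_apply, finsetSum_coeff, coeff_smul,
    smul_eq_mul]
  split_ifs with h
  · rw [Finset.sum_eq_single ⟨i, h.1⟩]
    · simp [h.2]
    · intro j _ hj
      have : i ≠ j := fun h' => hj (Fin.ext h'.symm)
      split_ifs <;> simp [coeff_X_pow, this]
    · simp
  · refine Finset.sum_eq_zero fun j _ => ?_
    have := j.2
    split_ifs with h'
    · have : i ≠ j := by omega
      simp [coeff_X_pow, this]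
    · simp

lemma coeff_linPart {k : ℕ} (u : Fin k → F) (i : ℕ) :
    (linPart k u).coeff i = if h : i + k / 2 + 1 < k then u ⟨i + k / 2 + 1, h⟩ else 0 := by
  simp only [linPart, Fintype.linearCombination_apply, finsetSum_coeff, coeff_smul,
    smul_eq_mul]
  split_ifs with h
  · rw [Finset.sum_eq_single ⟨i + k / 2 + 1, h⟩]
    · have h1 : ¬ i + k / 2 + 1 ≤ k / 2 := by omega
      have h2 : i = i + k / 2 + 1 - k / 2 - 1 := by omega
      simp [h1, coeff_X_pow, ← h2]
    · intro j _ hj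
      have : (j : ℕ) ≠ i + k / 2 + 1 := fun h' => hj (Fin.ext h')
      split_ifs with h'
      · simp
      · have : i ≠ j - k / 2 - 1 := by omega
        simp [coeff_X_pow, this]
    · simp
  · refine Finset.sum_eq_zero fun j _ => ?_
    have := j.2
    split_ifs with h'
    · simp
    · have : i ≠ j - k / 2 - 1 := by omega
      simp [coeff_X_pow, this]

/-- The element of `L(kO)`, as a function in the affine coordinate ring, with given coefficients
with respect to the monomial basis. -/
noncomputable def rrFun (W : WeierstrassCurve.Affine F) (k : ℕ) :
    (Fin k → F) →ₗ[F] W.CoordinateRing :=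
  (LinearMap.toSpanSingleton F[X] W.CoordinateRing 1).restrictScalars F ∘ₗ constPart k +
    (LinearMap.toSpanSingleton F[X] W.CoordinateRing (CoordinateRing.mk W Y)).restrictScalars F ∘ₗ
      linPart k

lemma rrFun_apply (W : WeierstrassCurve.Affine F) {k : ℕ} (u : Fin k → F) :
    rrFun W k u = constPart k u • 1 + linPart k u • CoordinateRing.mk W Y := rfl

lemma rrFun_injective (W : WeierstrassCurve.Affine F) (k : ℕ) :
    Function.Injective (rrFun W k) := by
  refine (injective_iff_map_eq_zero _).2 fun u hu => ?_
  rw [rrFun_apply] at hu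
  obtain ⟨hp, hq⟩ := CoordinateRing.smul_basis_eq_zero hu
  ext j
  by_cases hj : (j : ℕ) ≤ k / 2
  · simpa [hp, hj] using (coeff_constPart u j).symm
  · have h1 : (j : ℕ) - k / 2 - 1 + k / 2 + 1 = j := by omega
    simpa [hq, h1] using (coeff_linPart u (j - k / 2 - 1)).symm

lemma natDegree_norm_rrFun_le (W : WeierstrassCurve.Affine F) {k : ℕ} (u : Fin k → F) :
    (Algebra.norm F[X] (rrFun W k u)).natDegree ≤ k := by
  rw [rrFun_apply, CoordinateRing.natDegree_norm_le_iff]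
  simp only [coeff_constPart, coeff_linPart]
  refine ⟨fun i hi => ?_, fun i hi => ?_⟩ <;> split_ifs at hi
  · omega
  · exact absurd rfl hi
  · omega
  · exact absurd rfl hi

lemma natDegree_norm_rrFun_lt (W : WeierstrassCurve.Affine F) {k : ℕ} {u : Fin k → F}
    {l : Fin k} (hl : (l : ℕ) = if k % 2 = 0 then k / 2 else k - 1) (hu : u l = 0) :
    (Algebra.norm F[X] (rrFun W k u)).natDegree ≤ k - 1 := by
  rw [rrFun_apply, CoordinateRing.natDegree_norm_le_iff]
  simp only [coeff_constPart, coeff_linPart]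
  refine ⟨fun i hi => ?_, fun i hi => ?_⟩ <;> split_ifs at hi with h
  · have : i ≠ l := by rintro rfl; exact hi hu
    split_ifs at hl <;> omega
  · exact absurd rfl hi
  · have : i + k / 2 + 1 ≠ l := fun h' => hi (by rw [← hu]; congr)
    split_ifs at hl <;> omega
  · exact absurd rfl hi

/-- Evaluation of functions at an affine rational point. -/
noncomputable def evalPoint {s t : F} {P : F × F} (hP : onCurve s t P) :
    (shortCurve s t).CoordinateRing →ₐ[F] F :=
  AdjoinRoot.liftAlgHom _ (aeval P.1) P.2 <| by
    have := hP
    simp [onCurve] at this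
    simp [WeierstrassCurve.Affine.polynomial, this, eval₂_pow]

lemma evalPoint_smul {s t : F} {P : F × F} (hP : onCurve s t P) (p : F[X])
    (f : (shortCurve s t).CoordinateRing) :
    evalPoint hP (p • f) = p.eval P.1 * evalPoint hP f := by
  rw [CoordinateRing.smul, map_mul]
  congr 1
  simp [evalPoint]

lemma evalPoint_Y {s t : F} {P : F × F} (hP : onCurve s t P) :
    evalPoint hP (CoordinateRing.mk _ Y) = P.2 := by
  simp [evalPoint]

lemma evalPoint_rrFun {s t : F} {P : F × F} (hP : onCurve s t P) {k : ℕ} (u : Fin k → F) :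
    evalPoint hP (rrFun _ k u) = ∑ j, u j * phiAff k P j := by
  simp only [rrFun_apply, map_add, evalPoint_smul, map_one, evalPoint_Y, constPart, linPart,
    Fintype.linearCombination_apply, eval_finsetSum, Finset.sum_mul, ← Finset.sum_add_distrib,
    eval_smul, smul_eq_mul, phiAff]
  refine Finset.sum_congr rfl fun j _ => ?_
  split_ifs <;> simp; ring

lemma evalPoint_injective {s t : F} {P Q : F × F} (hP : onCurve s t P) (hQ : onCurve s t Q)
    (h : evalPoint hP = evalPoint hQ) : P = Q := by
  refine Prod.ext ?_ ?_
  · have := DFunLike.congr_fun h ((X : F[X]) • 1)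
    rwa [evalPoint_smul, evalPoint_smul, map_one, map_one, eval_X, eval_X, mul_one, mul_one]
      at this
  · rw [← evalPoint_Y hP, ← evalPoint_Y hQ, h]

/-- Any `k - 1` columns of `H(k)` are linearly independent. -/
lemma linearIndependent_phiAff {ι : Type*} [Fintype ι] {s t : F} {P : ι → F × F}
    (hPinj : Function.Injective P) (hP : ∀ i, onCurve s t (P i)) {k : ℕ} (hk : 2 ≤ k)
    (hι : Fintype.card ι = k - 1) :
    LinearIndependent F fun i => phiAff k (P i) := by
  classical
  let M : (Fin k → F) →ₗ[F] ι → F := LinearMap.pi fun i =>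
    (evalPoint (hP i)).toLinearMap ∘ₗ rrFun (shortCurve s t) k
  have hM (u : Fin k → F) (i : ι) : M u i = ∑ j, u j * phiAff k (P i) j :=
    evalPoint_rrFun (hP i) u
  have he : Function.Injective fun i => evalPoint (hP i) :=
    fun i j hij => hPinj (evalPoint_injective _ _ hij)
  obtain ⟨l, hl⟩ : ∃ l : Fin k, (l : ℕ) = if k % 2 = 0 then k / 2 else k - 1 :=
    ⟨⟨if k % 2 = 0 then k / 2 else k - 1, by split_ifs <;> omega⟩, rfl⟩
  have hker : Module.finrank F (LinearMap.ker M) ≤ 1 := by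
    by_cases h : ∃ u ∈ LinearMap.ker M, u ≠ 0 ∧ u l = 0
    · obtain ⟨u, huM, hu0, hul⟩ := h
      refine finrank_le_one (⟨u, huM⟩ : LinearMap.ker M) fun ⟨w, hw⟩ => ?_
      obtain ⟨c, hc⟩ := CoordinateRing.exists_eq_smul_of_vanishing he
        (f := rrFun (shortCurve s t) k u) (g := rrFun (shortCurve s t) k w)
        ((map_ne_zero_iff _ (rrFun_injective _ k)).2 hu0)
        (fun i => congrFun (LinearMap.mem_ker.1 huM) i)
        (fun i => congrFun (LinearMap.mem_ker.1 hw) i)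
        (hι ▸ natDegree_norm_rrFun_lt _ hl hul)
        ((natDegree_norm_rrFun_le _ w).trans (by omega))
      rw [← map_smul] at hc
      exact ⟨c, Subtype.ext (rrFun_injective _ k hc).symm⟩
    · push Not at h
      let φ : LinearMap.ker M →ₗ[F] F := LinearMap.proj l ∘ₗ (LinearMap.ker M).subtype
      have hφ : Function.Injective φ := by
        refine (injective_iff_map_eq_zero _).2 fun ⟨u, hu⟩ hul => ?_
        by_contra hne
        exact h u hu (fun h0 => hne (Subtype.ext h0)) hul
      simpa using LinearMap.finrank_le_finrank_of_injective hφ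
  have hsurj : Function.Surjective M := by
    rw [← LinearMap.range_eq_top]
    refine Submodule.eq_top_of_finrank_eq (le_antisymm (Submodule.finrank_le _) ?_)
    have := M.finrank_range_add_finrank_ker
    simp only [Module.finrank_fintype_fun_eq_card, Fintype.card_fin, hι] at this ⊢
    omega
  refine Fintype.linearIndependent_iff.2 fun c hc i => ?_
  obtain ⟨u, hu⟩ := hsurj (Pi.single i 1)
  have : ∑ i', c i' * M u i' = 0 := by
    simp_rw [hM, Finset.mul_sum]
    rw [Finset.sum_comm]
    refine Finset.sum_eq_zero fun j _ => ?_
    have := congrFun hc j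
    simp only [Finset.sum_apply, Pi.smul_apply, smul_eq_mul, Pi.zero_apply] at this
    rw [← mul_zero (u j), ← this, Finset.mul_sum]
    exact Finset.sum_congr rfl fun _ _ => by ring
  simpa [hu, Pi.single_apply] using this

end RiemannRochSpace

lemma dTo_le_covRad {F : Type*} [DecidableEq F] [Finite F] {n : ℕ} (v : Fin n → F)
    (C : Set (Fin n → F)) : dTo v C ≤ covRad C :=
  le_csSup (Set.finite_range _).bddAbove ⟨v, rfl⟩

section ErrorDistance

variable {F : Type*} [Field F] {n k : ℕ} {P : Fin n → F × F}

lemma Hmat_mulVec (P : Fin n → F × F) (e : Fin n → F) :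
    Hmat k P *ᵥ e = ∑ i, e i • phiAff k (P i) := by
  ext j
  simp [Matrix.mulVec, dotProduct, Hmat, Finset.sum_apply, mul_comm]

variable [DecidableEq F]

/-- The error distance is at most `m` iff the syndrome is a combination of `m` columns. -/
lemma dTo_resCode_le_iff (v : Fin n → F) (m : ℕ) :
    dTo v (resCode k P) ≤ m ↔ ∃ T : Finset (Fin n), T.card ≤ m ∧
      Hmat k P *ᵥ v ∈ Submodule.span F ((fun i => phiAff k (P i)) '' (T : Set (Fin n))) := by
  constructor
  · intro h
    have hne : (hammingDist v '' resCode k P).Nonempty :=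
      ⟨_, 0, by simp [resCode], rfl⟩
    obtain ⟨c, hc, hd⟩ := Nat.sInf_mem hne
    refine ⟨Finset.univ.filter fun i => v i ≠ c i, hd.trans_le h, ?_⟩
    rw [Submodule.mem_span_image_finset_iff_exists_fun']
    refine ⟨v - c, ?_⟩
    have hvc : Hmat k P *ᵥ v = Hmat k P *ᵥ (v - c) := by
      rw [Matrix.mulVec_sub, show Hmat k P *ᵥ c = 0 from hc, sub_zero]
    rw [hvc, Hmat_mulVec]
    refine Finset.sum_subset (Finset.subset_univ _) fun i _ hi => ?_
    have : v i = c i := by simpa using hi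
    simp [this]
  · rintro ⟨T, hT, hv⟩
    obtain ⟨e, he⟩ := Submodule.mem_span_image_finset_iff_exists_fun' F |>.1 hv
    let e' : Fin n → F := fun i => if i ∈ T then e i else 0
    have he' : Hmat k P *ᵥ e' = Hmat k P *ᵥ v := by
      rw [Hmat_mulVec, ← he]
      simp [e', ite_smul]
    have hmem : v - e' ∈ resCode k P := by
      change Hmat k P *ᵥ (v - e') = 0
      rw [Matrix.mulVec_sub, he', sub_self]
    refine (Nat.sInf_le (Set.mem_image_of_mem _ hmem)).trans (le_trans ?_ hT)
    refine Finset.card_le_card fun i hi => ?_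
    by_contra hiT
    simp [e', hiT] at hi

end ErrorDistance

section Snoc

variable {K V : Type*} [Field K] [AddCommGroup V] [Module K V] {n : ℕ}

lemma linearIndepOn_snoc_map_castSucc (h : Fin n → V) (w : V) (T : Finset (Fin n)) :
    LinearIndepOn K (Fin.snoc h w : Fin (n + 1) → V)
      (T.map Fin.castSuccEmb : Finset (Fin (n + 1))) ↔ LinearIndepOn K h (T : Set (Fin n)) := by
  have hcomp : (Fin.snoc h w : Fin (n + 1) → V) ∘ Fin.castSuccEmb = h := by
    ext i
    simp
  rw [Finset.coe_map]
  nth_rw 2 [← hcomp]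
  exact ⟨fun H => H.comp_of_image Fin.castSuccEmb.injective.injOn, fun H => H.image_of_comp _ _⟩

lemma linearIndepOn_snoc_insert_last (h : Fin n → V) (w : V) (T : Finset (Fin n)) :
    LinearIndepOn K (Fin.snoc h w : Fin (n + 1) → V)
      (insert (Fin.last n) (T.map Fin.castSuccEmb) : Finset (Fin (n + 1))) ↔
      LinearIndepOn K h (T : Set (Fin n)) ∧ w ∉ Submodule.span K (h '' T) := by
  rw [Finset.coe_insert, linearIndepOn_insert (by simp), linearIndepOn_snoc_map_castSucc,
    Fin.snoc_last, Finset.coe_map, Set.image_image]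
  simp

end Snoc

lemma card_insert_last_map_castSucc {n : ℕ} (T : Finset (Fin n)) :
    (insert (Fin.last n) (T.map Fin.castSuccEmb)).card = T.card + 1 := by
  rw [Finset.card_insert_of_notMem (by simp), Finset.card_map]

lemma exists_eq_map_castSucc {n : ℕ} (S : Finset (Fin (n + 1))) :
    ∃ T : Finset (Fin n), S = T.map Fin.castSuccEmb ∨
      S = insert (Fin.last n) (T.map Fin.castSuccEmb) := by
  refine ⟨Finset.univ.filter fun i => i.castSucc ∈ S, ?_⟩
  by_cases hS : Fin.last n ∈ S
  · right
    ext j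
    refine Fin.lastCases ?_ (fun i => ?_) j <;> simp [hS]
  · left
    ext j
    refine Fin.lastCases ?_ (fun i => ?_) j <;> simp [hS]

/-- **Proposition 4.5.** Suppose `C = C_Ω(D,kO)` has covering radius `k−1`.
A word `v` is a deep hole of `C` iff the `n+1` vectors `h_1, …, h_n, H(k)vᵀ` (columns of
`H(k)` together with the syndrome) form an `(n+1)`-track in `PG(k−1,q)`: every `k−1` of
them are linearly independent, and some `k` of them are linearly dependent. -/
theorem deep_hole_iff_track
    (F : Type) [Field F] [Fintype F] [DecidableEq F]
    (hq : Odd (Fintype.card F))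
    (s t : F) (hdisc : 4 * s ^ 3 + 27 * t ^ 2 ≠ 0)
    {n : ℕ} (k : ℕ) (P : Fin n → F × F)
    (hPinj : Function.Injective P)
    (hPcurve : ∀ i, onCurve s t (P i))
    (hk2 : 2 ≤ k) (hkn : k ≤ n - 2)
    (hρ : covRad (resCode k P) = k - 1)
    (v : Fin n → F)
    (g : Fin (n + 1) → Fin k → F)
    (hg : g = Fin.snoc (fun j => phiAff k (P j)) (Matrix.mulVec (Hmat k P) v)) :
    dTo v (resCode k P) = covRad (resCode k P) ↔
      ((∀ S : Finset (Fin (n + 1)), S.card = k - 1 →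
          LinearIndependent F ((S : Set (Fin (n + 1))).restrict g)) ∧
        ∃ S : Finset (Fin (n + 1)), S.card = k ∧
          ¬ LinearIndependent F ((S : Set (Fin (n + 1))).restrict g)) := by
  classical
  set h : Fin n → Fin k → F := fun j => phiAff k (P j)
  set w := Hmat k P *ᵥ v
  subst hg
  have hle : dTo v (resCode k P) ≤ k - 1 := hρ ▸ dTo_le_covRad v _
  have hpad (T : Finset (Fin n)) (m : ℕ) (hT : T.card ≤ m) (hm : m ≤ k - 1) :
      ∃ T', T ⊆ T' ∧ T'.card = m :=
    Finset.exists_superset_card_eq hT (by rw [Fintype.card_fin]; omega)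
  have hind (T : Finset (Fin n)) (hT : T.card ≤ k - 1) :
      LinearIndepOn F h (T : Set (Fin n)) := by
    obtain ⟨T', hTT', hT'⟩ := hpad T _ hT le_rfl
    refine LinearIndepOn.mono ?_ (Finset.coe_subset.2 hTT')
    exact linearIndependent_phiAff (ι := T') (hPinj.comp Subtype.val_injective)
      (fun i => hPcurve i) hk2 (by simpa using hT')
  have hdeep : dTo v (resCode k P) = k - 1 ↔ ¬ dTo v (resCode k P) ≤ k - 2 := by omega
  rw [hρ, hdeep, dTo_resCode_le_iff]
  constructor
  · intro hv
    refine ⟨fun S hS => ?_, ?_⟩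
    · obtain ⟨T, rfl | rfl⟩ := exists_eq_map_castSucc S
      · rw [Finset.card_map] at hS
        exact (linearIndepOn_snoc_map_castSucc h w T).2 (hind T hS.le)
      · rw [card_insert_last_map_castSucc] at hS
        exact (linearIndepOn_snoc_insert_last h w T).2
          ⟨hind T (by omega), fun hw => hv ⟨T, by omega, hw⟩⟩
    · obtain ⟨T, hT, hw⟩ := (dTo_resCode_le_iff v _).1 hle
      obtain ⟨T', hTT', hT'⟩ := hpad T _ hT le_rfl
      refine ⟨insert (Fin.last n) (T'.map Fin.castSuccEmb), ?_, fun hS => ?_⟩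
      · rw [card_insert_last_map_castSucc]
        omega
      · exact ((linearIndepOn_snoc_insert_last h w T').1 hS).2
          (Submodule.span_mono (Set.image_mono (Finset.coe_subset.2 hTT')) hw)
  · rintro ⟨hS, -⟩ ⟨T, hT, hw⟩
    obtain ⟨T', hTT', hT'⟩ := hpad T _ hT (by omega)
    exact ((linearIndepOn_snoc_insert_last h w T').1
      (hS _ (by rw [card_insert_last_map_castSucc]; omega))).2
      (Submodule.span_mono (Set.image_mono (Finset.coe_subset.2 hTT')) hw)
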